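/- Let Γ be an n-vertex connected nonregular finite simple graph whose adjacency matrix has exactly three distinct eigenvalues s > 1 > −t, which is not a cone and not biregular. Let x be a vertex with d_x = Δ(Γ) and y a vertex with d_x > d_y, and write α_v := √(d_v − t). Then: (a) if x and y are adjacent and α_x ≥ α_y + 4 ≥ 8, then α_x ≤ (t+7)/2; (b) if x and y are not adjacent and α_x ≥ α_y + 2 ≥ 4, then α_x ≤ (t+4)/2. -/

import Mathlib

open Matrix in
/-- A Hermitian matrix is annihilated by any polynomial vanishing on its spectrum; here for three
prescribed eigenvalues. -/
lemma Matrix.IsHermitian.mul_sub_eq_zero_of_spectrum_subset {n : Type*} [Fintype n] [DecidableEq n]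
    {A : Matrix n n ℝ} (hA : A.IsHermitian) {a b c : ℝ} (h : spectrum ℝ A ⊆ {a, b, c}) :
    (A - a • 1) * ((A - b • 1) * (A - c • 1)) = 0 := by
  have hev (i : n) : hA.eigenvalues i = a ∨ hA.eigenvalues i = b ∨ hA.eigenvalues i = c := by
    simpa using h (hA.eigenvalues_mem_spectrum_real i)
  set φ := Unitary.conjStarAlgAut ℝ (Matrix n n ℝ) hA.eigenvectorUnitary with hφ
  set D : Matrix n n ℝ := diagonal (RCLike.ofReal ∘ hA.eigenvalues) with hD
  have hAD : A = φ D := hA.spectral_theorem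
  have hsub (r : ℝ) : A - r • 1 = φ (D - r • 1) := by
    rw [map_sub, map_smul, map_one, ← hAD]
  have hdiag (r : ℝ) : D - r • 1 = diagonal (fun i => hA.eigenvalues i - r) := by
    rw [smul_one_eq_diagonal, hD, diagonal_sub]
    rfl
  rw [hsub, hsub, hsub, ← map_mul, ← map_mul, hdiag, hdiag, hdiag, diagonal_mul_diagonal,
    diagonal_mul_diagonal]
  convert map_zero φ
  rw [← diagonal_zero]
  congr 1
  ext i
  rcases hev i with h | h | h <;> simp [h]

open Matrix in
/-- An upper bound `s` for the spectrum of a Hermitian matrix `A` makes `s • 1 - A` positive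
semidefinite. -/
lemma Matrix.IsHermitian.posSemidef_smul_one_sub {n : Type*} [Fintype n] [DecidableEq n]
    {A : Matrix n n ℝ} (hA : A.IsHermitian) {s : ℝ} (h : ∀ r ∈ spectrum ℝ A, r ≤ s) :
    (s • 1 - A).PosSemidef := by
  rw [posSemidef_iff_isHermitian_and_spectrum_nonneg]
  refine ⟨(isHermitian_one.smul (IsSelfAdjoint.all s)).sub hA, ?_⟩
  rw [← Algebra.algebraMap_eq_smul_one, ← spectrum.singleton_sub_eq]
  rintro _ ⟨_, rfl, r, hr, rfl⟩
  exact sub_nonneg.2 (h r hr)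

namespace SimpleGraph

open Matrix

lemma isHermitian_adjMatrix_real {V : Type*} (G : SimpleGraph V) [DecidableRel G.Adj] :
    (G.adjMatrix ℝ).IsHermitian := by
  rw [IsHermitian, conjTranspose_eq_transpose_of_trivial, G.isSymm_adjMatrix]

variable {V : Type*} [Fintype V] [DecidableEq V] {G : SimpleGraph V} [DecidableRel G.Adj]

/-- The absolute value of an eigenvector for the largest adjacency eigenvalue is again an
eigenvector. -/
lemma adjMatrix_mulVec_abs_eq {s : ℝ} (h : ∀ r ∈ spectrum ℝ (G.adjMatrix ℝ), r ≤ s)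
    {v : V → ℝ} (hv : G.adjMatrix ℝ *ᵥ v = s • v) :
    G.adjMatrix ℝ *ᵥ |v| = s • |v| := by
  have hP := G.isHermitian_adjMatrix_real.posSemidef_smul_one_sub h
  have hmul (w : V → ℝ) : (s • 1 - G.adjMatrix ℝ) *ᵥ w = s • w - G.adjMatrix ℝ *ᵥ w := by
    rw [sub_mulVec, smul_mulVec, one_mulVec]
  suffices hz : (s • 1 - G.adjMatrix ℝ) *ᵥ |v| = 0 by
    rw [hmul, sub_eq_zero] at hz
    exact hz.symm
  rw [← hP.dotProduct_mulVec_zero_iff]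
  refine le_antisymm ?_ (hP.dotProduct_mulVec_nonneg _)
  have hv0 : v ⬝ᵥ (s • 1 - G.adjMatrix ℝ) *ᵥ v = 0 := by
    rw [hmul, hv, sub_self, dotProduct_zero]
  rw [star_trivial, ← hv0, hmul, hmul, dotProduct_sub, dotProduct_sub]
  refine sub_le_sub (le_of_eq ?_) ?_
  · simp [dotProduct, mul_left_comm]
  · refine Finset.sum_le_sum fun u _ => ?_
    rw [adjMatrix_mulVec_apply, adjMatrix_mulVec_apply, Finset.mul_sum, Finset.mul_sum]
    refine Finset.sum_le_sum fun w _ => ?_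
    rw [Pi.abs_apply, Pi.abs_apply, ← abs_mul]
    exact le_abs_self _

/-- In a connected graph, an eigenvector for the largest adjacency eigenvalue with a zero entry
vanishes. -/
lemma Connected.eq_zero_of_adjMatrix_mulVec_eq (hG : G.Connected) {s : ℝ}
    (h : ∀ r ∈ spectrum ℝ (G.adjMatrix ℝ), r ≤ s) {v : V → ℝ}
    (hv : G.adjMatrix ℝ *ᵥ v = s • v) {x : V} (hx : v x = 0) : v = 0 := by
  have habs := adjMatrix_mulVec_abs_eq h hv
  have hstep {u w : V} (huw : G.Adj u w) (hu : v u = 0) : v w = 0 := by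
    have hsum := congrFun habs u
    rw [adjMatrix_mulVec_apply, Pi.smul_apply, Pi.abs_apply, hu, abs_zero, smul_zero,
      Finset.sum_eq_zero_iff_of_nonneg fun z _ => (abs_nonneg v : 0 ≤ |v|) z] at hsum
    exact abs_eq_zero.1 (hsum w ((G.mem_neighborFinset u w).2 huw))
  ext y
  obtain ⟨p⟩ := hG.preconnected x y
  induction p with
  | nil => exact hx
  | cons hadj _ ih => exact ih (hstep hadj hx)

/-- If a symmetric matrix has all columns in the top eigenspace of a connected graph, then its
`2 × 2` principal minors vanish. -/
lemma Connected.apply_mul_apply_eq_sq (hG : G.Connected) {s : ℝ}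
    (h : ∀ r ∈ spectrum ℝ (G.adjMatrix ℝ), r ≤ s) {M : Matrix V V ℝ} (hM : M.IsSymm)
    (hGM : (G.adjMatrix ℝ - s • 1) * M = 0) (x y : V) : M x x * M y y = M x y ^ 2 := by
  have hcol (z : V) : G.adjMatrix ℝ *ᵥ M.col z = s • M.col z := by
    ext u
    have hu := congrFun (congrFun hGM u) z
    rw [sub_mul, smul_mul_assoc, one_mul, Matrix.sub_apply, Matrix.zero_apply, sub_eq_zero] at hu
    exact hu
  have hz := hG.eq_zero_of_adjMatrix_mulVec_eq h (v := M y y • M.col x - M y x • M.col y) (x := y)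
    (by rw [mulVec_sub, mulVec_smul, mulVec_smul, hcol, hcol, smul_sub, smul_comm s,
      smul_comm s]) (by simp [mul_comm])
  have hzx := congrFun hz x
  simp only [Pi.sub_apply, Pi.smul_apply, col_apply, smul_eq_mul, Pi.zero_apply, hM.apply x y]
    at hzx
  linarith

/-- If the adjacency eigenvalues of a connected graph are `s > 1 > -t`, then `√(d x - t) √(d y - t)`
is the absolute value of the `(x, y)` entry of `(A - 1) (A + t)`. -/
lemma Connected.sqrt_degree_sub_mul_sqrt_degree_sub (hG : G.Connected) {s t : ℝ} (hs : 1 < s)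
    (ht : -t < 1) (hspec : spectrum ℝ (G.adjMatrix ℝ) = {s, 1, -t}) {x y : V} (hxy : x ≠ y)
    (hx : t ≤ G.degree x) :
    √(G.degree x - t) * √(G.degree y - t) =
      |(Fintype.card (G.commonNeighbors x y) : ℝ) + (t - 1) * G.adjMatrix ℝ x y| := by
  set A := G.adjMatrix ℝ with hA
  have hsymm : A.IsSymm := G.isSymm_adjMatrix
  set M : Matrix V V ℝ := (A - (1 : ℝ) • 1) * (A - (-t) • 1) with hMdef
  have hM : M = A * A + (t - 1) • A - t • 1 := by
    rw [hMdef, one_smul, neg_smul, sub_neg_eq_add, sub_mul, mul_add, one_mul, mul_smul_comm,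
      mul_one, sub_smul, one_smul]
    abel
  have hMsymm : M.IsSymm := by
    rw [hM]
    refine ((IsSymm.add ?_ (hsymm.smul _)).sub (isSymm_one.smul _))
    rw [IsSymm, transpose_mul, hsymm.eq]
  have hdiag (z : V) : M z z = G.degree z - t := by
    rw [hM, Matrix.sub_apply, Matrix.add_apply, hA, adjMatrix_mul_self_apply_self]
    simp
  have hoff : M x y = (Fintype.card (G.commonNeighbors x y) : ℝ) + (t - 1) * A x y := by
    have hsq : (A * A) x y = Fintype.card (G.commonNeighbors x y) := by
      rw [hA, adjMatrix_mul_apply, ← Set.toFinset_card]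
      simp only [adjMatrix_apply, Finset.sum_boole]
      congr 2
      ext z
      simp [mem_commonNeighbors, adj_comm]
    simp [hM, hsq, one_apply_ne hxy]
  have hminor := hG.apply_mul_apply_eq_sq (by
      rw [hspec]
      rintro r (rfl | rfl | rfl) <;> linarith) hMsymm
    (G.isHermitian_adjMatrix_real.mul_sub_eq_zero_of_spectrum_subset hspec.subset) x y
  rw [← hoff, ← Real.sqrt_sq_eq_abs, ← hminor, hdiag, hdiag, Real.sqrt_mul (sub_nonneg.2 hx)]

end SimpleGraph

/-- For a graph in H′(s,t) and a vertex x of maximum degree and y with d_x > d_y: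
(a) if x ~ y and α_x ≥ α_y + 4 ≥ 8 then α_x ≤ (t+7)/2;
(b) if x ≁ y and α_x ≥ α_y + 2 ≥ 4 then α_x ≤ (t+4)/2. -/
theorem H'_st_alpha_gap_bounds
    {V : Type} [Fintype V] [DecidableEq V] (Γ : SimpleGraph V) [DecidableRel Γ.Adj]
    (s t : ℝ)
    (hconn : Γ.Connected)
    (hnonreg : ¬ ∃ k, Γ.IsRegularOfDegree k)
    (hs : 1 < s) (ht : -t < 1)
    (hspec : spectrum ℝ (Γ.adjMatrix ℝ) = {s, 1, -t})
    (hnotcone : ¬ ∃ v : V, Γ.degree v = Fintype.card V - 1)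
    (hnotbireg : ((Finset.univ : Finset V).image (fun v => Γ.degree v)).card ≠ 2)
    (x y : V)
    (hx : Γ.degree x = Γ.maxDegree)
    (hxy : Γ.degree y < Γ.degree x) :
    (Γ.Adj x y →
      Real.sqrt ((Γ.degree x : ℝ) - t) ≥ Real.sqrt ((Γ.degree y : ℝ) - t) + 4 →
      Real.sqrt ((Γ.degree y : ℝ) - t) + 4 ≥ 8 →
      Real.sqrt ((Γ.degree x : ℝ) - t) ≤ (t + 7) / 2) ∧
    (¬ Γ.Adj x y →
      Real.sqrt ((Γ.degree x : ℝ) - t) ≥ Real.sqrt ((Γ.degree y : ℝ) - t) + 2 →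
      Real.sqrt ((Γ.degree y : ℝ) - t) + 2 ≥ 4 →
      Real.sqrt ((Γ.degree x : ℝ) - t) ≤ (t + 4) / 2) := by
  have hne : y ≠ x := by
    rintro rfl
    exact hxy.ne rfl
  have hsq (hpos : 0 < √((Γ.degree y : ℝ) - t)) :
      √((Γ.degree y : ℝ) - t) ^ 2 = Γ.degree y - t :=
    Real.sq_sqrt (Real.sqrt_pos.1 hpos).le
  have hprod (hpos : 0 < √((Γ.degree y : ℝ) - t)) :=
    hconn.sqrt_degree_sub_mul_sqrt_degree_sub hs ht hspec hne
      (sub_nonneg.1 (Real.sqrt_pos.1 hpos).le)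
  constructor
  · intro hadj h1 h2
    have hpos : 0 < √((Γ.degree y : ℝ) - t) := by linarith
    have hy := hsq hpos
    have hcn : (Fintype.card (Γ.commonNeighbors y x) : ℝ) + 1 ≤ Γ.degree y := by
      exact_mod_cast hadj.symm.card_commonNeighbors_lt_degree
    have hp := hprod hpos
    rw [SimpleGraph.adjMatrix_apply, if_pos hadj.symm, mul_one] at hp
    rcases abs_cases ((Fintype.card (Γ.commonNeighbors y x) : ℝ) + (t - 1)) with h | h <;>
      nlinarith [Nat.cast_nonneg (α := ℝ) (Fintype.card (Γ.commonNeighbors y x))]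
  · intro hadj h1 h2
    have hpos : 0 < √((Γ.degree y : ℝ) - t) := by linarith
    have hy := hsq hpos
    have hcn : (Fintype.card (Γ.commonNeighbors y x) : ℝ) ≤ Γ.degree y := by
      exact_mod_cast Γ.card_commonNeighbors_le_degree_left y x
    have hp := hprod hpos
    rw [SimpleGraph.adjMatrix_apply, if_neg fun h => hadj h.symm, mul_zero, add_zero,
      abs_of_nonneg (Nat.cast_nonneg _)] at hp
    nlinarith
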